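/- arXiv:1912.09355 — 3 statements merged into one kernel-verified Lean document; each statement's English description precedes it below -/
import Mathlib

section
/- The sum Σ_D γ_D over all finite sets D of positive integers (including D = ∅) converges and equals 1. -/
open Filter Topology Set

/-- A numerical set: a cofinite subset of ℕ containing 0, not all of ℕ. -/
def IsNumericalSet (T : Set ℕ) : Prop :=
  0 ∈ T ∧ Tᶜ.Finite ∧ Tᶜ.Nonempty

/-- A numerical semigroup: a numerical set closed under addition. -/
def IsNumericalSemigroup (S : Set ℕ) : Prop :=
  IsNumericalSet S ∧ ∀ a ∈ S, ∀ b ∈ S, a + b ∈ S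

/-- Frobenius number: the largest element of the complement. -/
noncomputable def frob (T : Set ℕ) : ℕ := sSup Tᶜ

/-- The associated semigroup `A(T) = {t | t + T ⊆ T}`. -/
def AT (T : Set ℕ) : Set ℕ := {t : ℕ | ∀ x ∈ T, t + x ∈ T}

/-- Multiplicity: the smallest positive element. -/
noncomputable def mult (S : Set ℕ) : ℕ := sInf {x | x ∈ S ∧ 0 < x}

/-- `R(S) = f(S) - m(S)` as an integer. -/
noncomputable def RVal (S : Set ℕ) : ℤ := (frob S : ℤ) - (mult S : ℤ)

/-- `P(S)`: the number of numerical sets whose associated semigroup is `S`. -/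
noncomputable def PCount (S : Set ℕ) : ℕ :=
  {T : Set ℕ | IsNumericalSet T ∧ AT T = S}.ncard

/-- The density `μ(S) = P(S) / 2^(f(S)-1)`. -/
noncomputable def density (S : Set ℕ) : ℝ :=
  (PCount S : ℝ) / 2 ^ (frob S - 1)

/-- The numerical semigroup `N(D,f) = {0} ∪ {f - l : l ∈ D} ∪ (f, ∞)`. -/
def NSet (D : Finset ℕ) (f : ℕ) : Set ℕ :=
  {0} ∪ (fun l => f - l) '' (D : Set ℕ) ∪ {x | f < x}

/-- `B(D,f)`: numerical sets `T` with `f(T) = f` and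
`A(T) ∩ [f - Max D, f - 1] = {f - l : l ∈ D}`. -/
def BSet (D : Finset ℕ) (f : ℕ) : Set (Set ℕ) :=
  {T | IsNumericalSet T ∧ frob T = f ∧
    AT T ∩ Set.Icc (f - D.sup id) (f - 1) = (fun l => f - l) '' (D : Set ℕ)}

/-- `A_D = |B(D, 2 Max D + 1)|`. -/
noncomputable def AConst (D : Finset ℕ) : ℕ :=
  (BSet D (2 * D.sup id + 1)).ncard

/-- `B_l(k,f) = {T ∈ B({k},f) : T ∩ [1,l] = ∅}`. -/
def BlSet (l k f : ℕ) : Set (Set ℕ) :=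
  {T | T ∈ BSet {k} f ∧ T ∩ Set.Icc 1 l = ∅}

/-- `C_{l,k}`. -/
noncomputable def CConst (l k : ℕ) : ℕ :=
  if l ≤ k then (BlSet l k (2 * k + 1)).ncard else (BlSet l k (l + k + 1)).ncard

/-- `G_l(f) = {T : A(T) = N_f, T ∩ [1,l] = ∅}`. -/
def GSet (l f : ℕ) : Set (Set ℕ) :=
  {T | IsNumericalSet T ∧ AT T = NSet ∅ f ∧ T ∩ Set.Icc 1 l = ∅}

/-- Numerical sets with Frobenius number `f`. -/
def numericalSetsOf (f : ℕ) : Set (Set ℕ) := {T | IsNumericalSet T ∧ frob T = f}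

theorem frob_eq_of {T : Set ℕ} {f : ℕ} (hf : f ∉ T) (h : ∀ x, f < x → x ∈ T) : frob T = f := by
  refine IsGreatest.csSup_eq ⟨hf, fun x hx => ?_⟩
  by_contra hlt
  exact hx (h x (by omega))

theorem mem_numericalSetsOf {T : Set ℕ} {f : ℕ} :
    T ∈ numericalSetsOf f ↔ 0 ∈ T ∧ f ∉ T ∧ ∀ x, f < x → x ∈ T := by
  constructor
  · rintro ⟨⟨h0, hfin, hne⟩, rfl⟩
    refine ⟨h0, Nat.sSup_mem hne hfin.bddAbove, fun x hx => ?_⟩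
    by_contra hxT
    exact absurd (le_csSup hfin.bddAbove hxT) (not_le.2 hx)
  · rintro ⟨h0, hf, h⟩
    refine ⟨⟨h0, (Set.finite_Iic f).subset fun x hx => ?_, f, hf⟩, frob_eq_of hf h⟩
    by_contra hlt
    exact hx (h x (by simpa using hlt))

theorem frob_AT {T : Set ℕ} {f : ℕ} (hT : T ∈ numericalSetsOf f) : frob (AT T) = f := by
  obtain ⟨h0, hf, h⟩ := mem_numericalSetsOf.1 hT
  exact frob_eq_of (fun hA => hf (hA 0 h0)) fun x hx y _ => h _ (by omega)

theorem add_mem_AT {T : Set ℕ} {s t : ℕ} (hs : s ∈ AT T) (ht : t ∈ AT T) : s + t ∈ AT T :=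
  fun x hx => by simpa [add_assoc] using hs _ (ht x hx)

theorem ncard_numericalSetsOf {f : ℕ} (hf : 0 < f) :
    (numericalSetsOf f).ncard = 2 ^ (f - 1) := by
  have hbij : Function.Bijective
      (fun (T : numericalSetsOf f) (i : Fin (f - 1)) => (i : ℕ) + 1 ∈ T.1) := by
    constructor
    · rintro ⟨S, hS⟩ ⟨T, hT⟩ hST
      obtain ⟨hS0, hSf, hS⟩ := mem_numericalSetsOf.1 hS
      obtain ⟨hT0, hTf, hT⟩ := mem_numericalSetsOf.1 hT
      refine Subtype.ext (Set.ext fun x => ?_)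
      rcases Nat.eq_zero_or_pos x with rfl | hx
      · exact iff_of_true hS0 hT0
      rcases lt_trichotomy x f with hxf | rfl | hxf
      · have := congrFun hST ⟨x - 1, by omega⟩
        simpa [Nat.sub_add_cancel hx] using this
      · exact iff_of_false hSf hTf
      · exact iff_of_true (hS x hxf) (hT x hxf)
    · intro g
      refine ⟨⟨{x | x = 0 ∨ f < x ∨ ∃ i : Fin (f - 1), x = i + 1 ∧ g i},
        mem_numericalSetsOf.2 ⟨Or.inl rfl, ?_, fun x hx => Or.inr (Or.inl hx)⟩⟩, ?_⟩
      · rintro (h | h | ⟨i, hi, -⟩)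
        · omega
        · omega
        · have := i.2
          omega
      · funext i
        refine propext ⟨?_, fun hi => Or.inr (Or.inr ⟨i, rfl, hi⟩)⟩
        rintro (h | h | ⟨j, hj, hgj⟩)
        · omega
        · have := i.2
          omega
        · rwa [show i = j from Fin.ext (by omega)]
  have := Nat.card_eq_of_bijective _ hbij
  rw [Nat.card_coe_set_eq] at this
  simp [this]

theorem finite_numericalSetsOf (f : ℕ) : (numericalSetsOf f).Finite := by
  rcases Nat.eq_zero_or_pos f with rfl | hf
  · convert Set.finite_empty
    refine Set.eq_empty_of_forall_notMem fun T hT => ?_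
    obtain ⟨h0, h0', -⟩ := mem_numericalSetsOf.1 hT
    exact h0' h0
  · exact Set.finite_of_ncard_pos (by rw [ncard_numericalSetsOf hf]; positivity)

/-- Each pair `(x, x + t)` with `1 ≤ x ≤ m` can meet `T` in only three of the four possible ways. -/
theorem ncard_mem_AT_le {f t m : ℕ} (hmt : m < t) (htf : t + m < f) :
    {T ∈ numericalSetsOf f | t ∈ AT T}.ncard ≤ 3 ^ m * 2 ^ (f - 1 - 2 * m) := by
  classical
  let code : {T ∈ numericalSetsOf f | t ∈ AT T} →
      (Fin m → Fin 3) × (Fin (t - m) → Prop) × (Fin (f - 1 - t - m) → Prop) := fun T =>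
    (fun i => if (i : ℕ) + 1 ∈ T.1 then 2 else if t + (i + 1) ∈ T.1 then 1 else 0,
      fun i => m + 1 + i ∈ T.1, fun i => t + m + 1 + i ∈ T.1)
  have hinj : Function.Injective code := by
    rintro ⟨S, hS, hSt⟩ ⟨T, hT, hTt⟩ hST
    obtain ⟨hS0, hSf, hS⟩ := mem_numericalSetsOf.1 hS
    obtain ⟨hT0, hTf, hT⟩ := mem_numericalSetsOf.1 hT
    simp only [code, Prod.mk.injEq] at hST
    obtain ⟨h₁, h₂, h₃⟩ := hST
    have key : ∀ x, 0 < x → x ≤ m → (x ∈ S ↔ x ∈ T) ∧ (t + x ∈ S ↔ t + x ∈ T) := by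
      intro x hx hxm
      have h := congrFun h₁ ⟨x - 1, by omega⟩
      simp only [Nat.sub_add_cancel hx] at h
      have hSx := hSt x
      have hTx := hTt x
      by_cases a : x ∈ S <;> by_cases b : x ∈ T <;> by_cases c : t + x ∈ S <;>
        by_cases d : t + x ∈ T <;> simp_all
    refine Subtype.ext (Set.ext fun x => ?_)
    change x ∈ S ↔ x ∈ T
    rcases Nat.eq_zero_or_pos x with rfl | hx
    · exact iff_of_true hS0 hT0
    rcases lt_trichotomy x f with hxf | rfl | hxf
    · by_cases hxm : x ≤ m
      · exact (key x hx hxm).1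
      by_cases hxt : x ≤ t
      · have := congrFun h₂ ⟨x - (m + 1), by omega⟩
        simpa [Nat.add_sub_of_le (show m + 1 ≤ x by omega)] using this
      by_cases hxtm : x ≤ t + m
      · simpa [Nat.add_sub_of_le (show t ≤ x by omega)] using
          (key (x - t) (by omega) (by omega)).2
      · have := congrFun h₃ ⟨x - (t + m + 1), by omega⟩
        simpa [Nat.add_sub_of_le (show t + m + 1 ≤ x by omega)] using this
    · exact iff_of_false hSf hTf
    · exact iff_of_true (hS x hxf) (hT x hxf)
  have hle := Nat.card_le_card_of_injective code hinj
  rw [Nat.card_coe_set_eq] at hle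
  refine hle.trans_eq ?_
  simp only [Nat.card_eq_fintype_card, Fintype.card_prod, Fintype.card_fun, Fintype.card_fin,
    Fintype.card_prop]
  rw [← pow_add]
  congr 2
  omega

theorem ncard_mem_AT_div_le {f l : ℕ} (hl : 0 < l) (hlf : l < f) (h : l ≤ 2 * (f - l)) :
    ({T ∈ numericalSetsOf f | f - l ∈ AT T}.ncard : ℝ) / 2 ^ (f - 1) ≤
      64 / 49 * (7 / 8) ^ l := by
  set m := (l - 1) / 2 with hm
  have hcard : ({T ∈ numericalSetsOf f | f - l ∈ AT T}.ncard : ℝ) ≤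
      3 ^ m * 2 ^ (f - 1 - 2 * m) := by
    exact_mod_cast ncard_mem_AT_le (f := f) (t := f - l) (m := m) (by omega) (by omega)
  have hpow : (2 : ℝ) ^ (f - 1) = 4 ^ m * 2 ^ (f - 1 - 2 * m) := by
    rw [show (4 : ℝ) = 2 ^ 2 by norm_num, ← pow_mul, ← pow_add]
    congr 1
    omega
  calc ({T ∈ numericalSetsOf f | f - l ∈ AT T}.ncard : ℝ) / 2 ^ (f - 1)
      ≤ (3 / 4) ^ m := by
        rw [div_le_iff₀ (by positivity), hpow, ← mul_assoc, ← mul_pow]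
        norm_num
        exact hcard
    _ ≤ ((7 / 8) ^ 2) ^ m := by gcongr; norm_num
    _ = 64 / 49 * (7 / 8) ^ (2 * m + 2) := by rw [← pow_mul, pow_add]; ring
    _ ≤ 64 / 49 * (7 / 8) ^ l := by
        gcongr ?_ * ?_
        exact pow_le_pow_of_le_one (by norm_num) (by norm_num) (by omega)

/-- Numerical sets whose associated semigroup is `N(D,f)`. -/
def setsOver (D : Finset ℕ) (f : ℕ) : Set (Set ℕ) := {T | IsNumericalSet T ∧ AT T = NSet D f}

theorem frob_NSet {D : Finset ℕ} (hD : ∀ d ∈ D, 0 < d) {f : ℕ} (hf : 0 < f) :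
    frob (NSet D f) = f := by
  refine frob_eq_of ?_ fun x hx => Or.inr hx
  rintro ((h | ⟨l, hl, hlf⟩) | h)
  · simp at h
    omega
  · have := hD l hl
    simp only at hlf
    omega
  · exact lt_irrefl f h

theorem density_NSet {D : Finset ℕ} (hD : ∀ d ∈ D, 0 < d) {f : ℕ} (hf : 0 < f) :
    density (NSet D f) = (setsOver D f).ncard / 2 ^ (f - 1) := by
  rw [density, frob_NSet hD hf]
  rfl

theorem setsOver_subset {D : Finset ℕ} (hD : ∀ d ∈ D, 0 < d) {f : ℕ} (hf : 0 < f) :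
    setsOver D f ⊆ numericalSetsOf f := by
  rintro T ⟨hT, hA⟩
  refine ⟨hT, ?_⟩
  rw [← frob_AT (f := frob T) ⟨hT, rfl⟩, hA, frob_NSet hD hf]

theorem mem_iff_sub_mem_NSet {D : Finset ℕ} {f l : ℕ} (hD : ∀ d ∈ D, d < f) (hlf : l < f) :
    l ∈ D ↔ f - l ∈ NSet D f := by
  constructor
  · exact fun hl => Or.inl (Or.inr ⟨l, hl, rfl⟩)
  · rintro ((h | ⟨k, hk, hkf⟩) | h)
    · simp at h
      omega
    · have := hD k hk
      simp only at hkf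
      rwa [show l = k by omega]
    · exact absurd h (Nat.sub_le f l).not_gt

theorem disjoint_setsOver {D E : Finset ℕ} {f : ℕ} (hD : ∀ d ∈ D, d < f) (hE : ∀ d ∈ E, d < f)
    (hne : D ≠ E) : Disjoint (setsOver D f) (setsOver E f) := by
  refine Set.disjoint_left.2 fun T hT hT' => hne ?_
  have hN : NSet D f = NSet E f := hT.2.symm.trans hT'.2
  ext l
  by_cases hl : l < f
  · rw [mem_iff_sub_mem_NSet hD hl, hN, mem_iff_sub_mem_NSet hE hl]
  · exact iff_of_false (fun h => hl (hD l h)) fun h => hl (hE l h)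

theorem exists_mem_AT_or_exists_mem_setsOver {f M : ℕ} (hf : 3 * M < f) {T : Set ℕ}
    (hT : T ∈ numericalSetsOf f) :
    (∃ D ∈ (Finset.Icc 1 M).powerset, T ∈ setsOver D f) ∨
      ∃ l ∈ Finset.Ico (M + 1) f, l ≤ 2 * (f - l) ∧ f - l ∈ AT T := by
  classical
  obtain ⟨h0, hfT, hlt⟩ := mem_numericalSetsOf.1 hT
  by_cases hex : ((Finset.Ico 1 (f - M)).filter (· ∈ AT T)).Nonempty
  · right
    obtain ⟨t, ht, hmax⟩ := Finset.exists_max_image _ id hex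
    simp only [Finset.mem_filter, Finset.mem_Ico, id] at ht hmax
    have h2t : f - M ≤ 2 * t := by
      by_contra hlt
      have := hmax (t + t) ⟨by omega, add_mem_AT ht.2 ht.2⟩
      omega
    refine ⟨f - t, Finset.mem_Ico.2 (by omega), by omega, ?_⟩
    rw [show f - (f - t) = t by omega]
    exact ht.2
  · left
    refine ⟨(Finset.Icc 1 M).filter (f - · ∈ AT T),
      Finset.mem_powerset.2 (Finset.filter_subset _ _), hT.1, ?_⟩
    have hempty : ∀ t, 0 < t → t < f - M → t ∉ AT T := fun t h1 h2 h3 =>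
      hex ⟨t, Finset.mem_filter.2 ⟨Finset.mem_Ico.2 ⟨h1, h2⟩, h3⟩⟩
    ext x
    constructor
    · intro hx
      rcases Nat.eq_zero_or_pos x with rfl | hx0
      · exact Or.inl (Or.inl rfl)
      rcases lt_trichotomy x f with hxf | rfl | hxf
      · have : ¬ x < f - M := fun h => hempty x hx0 h hx
        refine Or.inl (Or.inr ⟨f - x, ?_, by simp only; omega⟩)
        simp only [Finset.coe_filter, Finset.mem_Icc, Set.mem_ofPred_eq]
        rw [show f - (f - x) = x by omega]
        exact ⟨by omega, hx⟩
      · exact absurd (hx 0 h0) hfT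
      · exact Or.inr hxf
    · rintro ((rfl | ⟨l, hl, rfl⟩) | h)
      · intro y hy
        simpa using hy
      · exact (Finset.mem_filter.1 hl).2
      · exact fun y _ => hlt _ (lt_of_lt_of_le h (Nat.le_add_right x y))

theorem ncard_numericalSetsOf_le {f M : ℕ} (hf : 3 * M < f) :
    (numericalSetsOf f).ncard ≤ ∑ D ∈ (Finset.Icc 1 M).powerset, (setsOver D f).ncard +
      ∑ l ∈ Finset.Ico (M + 1) f with l ≤ 2 * (f - l),
        {T ∈ numericalSetsOf f | f - l ∈ AT T}.ncard := by
  have hfin := finite_numericalSetsOf f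
  refine le_trans ?_ ((Set.ncard_union_le _ _).trans (add_le_add
    (Finset.set_ncard_biUnion_le _ fun D => setsOver D f)
    (Finset.set_ncard_biUnion_le _ fun l => {T ∈ numericalSetsOf f | f - l ∈ AT T})))
  refine Set.ncard_le_ncard (fun T hT => ?_) (hfin.subset ?_)
  · rcases exists_mem_AT_or_exists_mem_setsOver hf hT with ⟨D, hD, h⟩ | ⟨l, hl, hl2, h⟩
    · exact Or.inl (Set.mem_biUnion hD h)
    · exact Or.inr (Set.mem_biUnion (x := l) (Finset.mem_filter.2 ⟨hl, hl2⟩) ⟨hT, h⟩)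
  · refine Set.union_subset (Set.iUnion₂_subset fun D hD => setsOver_subset (fun d hd => ?_)
      (by omega)) (Set.iUnion₂_subset fun l _ => Set.sep_subset _ _)
    exact (Finset.mem_Icc.1 (Finset.mem_powerset.1 hD hd)).1

theorem one_sub_le_sum_density {f M : ℕ} (hf : 3 * M < f) :
    1 - 64 / 49 * 8 * (7 / 8 : ℝ) ^ (M + 1) ≤
      ∑ D ∈ (Finset.Icc 1 M).powerset, density (NSet D f) := by
  have hpos : ∀ D ∈ (Finset.Icc 1 M).powerset, ∀ d ∈ D, 0 < d := fun D hD d hd =>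
    (Finset.mem_Icc.1 (Finset.mem_powerset.1 hD hd)).1
  have hcard : (2 : ℝ) ^ (f - 1) ≤ ∑ D ∈ (Finset.Icc 1 M).powerset, ((setsOver D f).ncard : ℝ) +
      ∑ l ∈ Finset.Ico (M + 1) f with l ≤ 2 * (f - l),
        ({T ∈ numericalSetsOf f | f - l ∈ AT T}.ncard : ℝ) := by
    have := ncard_numericalSetsOf_le hf
    rw [ncard_numericalSetsOf (by omega)] at this
    exact_mod_cast this
  have htail : (∑ l ∈ Finset.Ico (M + 1) f with l ≤ 2 * (f - l),
      ({T ∈ numericalSetsOf f | f - l ∈ AT T}.ncard : ℝ)) / 2 ^ (f - 1) ≤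
        64 / 49 * 8 * (7 / 8 : ℝ) ^ (M + 1) := by
    rw [Finset.sum_div]
    calc _ ≤ ∑ l ∈ Finset.Ico (M + 1) f with l ≤ 2 * (f - l), 64 / 49 * (7 / 8 : ℝ) ^ l := by
          refine Finset.sum_le_sum fun l hl => ?_
          simp only [Finset.mem_filter, Finset.mem_Ico] at hl
          exact ncard_mem_AT_div_le (by omega) (by omega) hl.2
      _ ≤ ∑ l ∈ Finset.Ico (M + 1) f, 64 / 49 * (7 / 8 : ℝ) ^ l :=
          Finset.sum_le_sum_of_subset_of_nonneg (Finset.filter_subset _ _)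
            fun _ _ _ => by positivity
      _ ≤ 64 / 49 * ((7 / 8 : ℝ) ^ (M + 1) / (1 - 7 / 8)) := by
          rw [← Finset.mul_sum]
          gcongr
          exact geom_sum_Ico_le_of_lt_one (by norm_num) (by norm_num)
      _ = _ := by ring
  rw [Finset.sum_congr rfl fun D hD => density_NSet (f := f) (hpos D hD) (by omega),
    ← Finset.sum_div]
  have h1 : (1 : ℝ) ≤ _ := (one_le_div (by positivity)).2 hcard
  rw [add_div] at h1
  linarith

theorem sum_density_le_one (s : Finset (Finset ℕ)) (hs : ∀ D ∈ s, ∀ d ∈ D, 0 < d) {f : ℕ}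
    (hf : 0 < f) (hsf : ∀ D ∈ s, ∀ d ∈ D, d < f) : ∑ D ∈ s, density (NSet D f) ≤ 1 := by
  rw [Finset.sum_congr rfl fun D hD => density_NSet (f := f) (hs D hD) hf, ← Finset.sum_div]
  refine div_le_one_of_le₀ ?_ (by positivity)
  have hfin := finite_numericalSetsOf f
  have hsub : (⋃ D ∈ s, setsOver D f) ⊆ numericalSetsOf f :=
    Set.iUnion₂_subset fun D hD => setsOver_subset (hs D hD) hf
  have hcard := Set.ncard_le_ncard hsub hfin
  have hdisj : (s : Set (Finset ℕ)).PairwiseDisjoint (setsOver · f) := fun D hD E hE hne =>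
    disjoint_setsOver (hsf D hD) (hsf E hE) hne
  have hunion := s.finite_toSet.ncard_biUnion
    (fun D hD => hfin.subset (setsOver_subset (hs D hD) hf)) hdisj
  rw [finsum_mem_coe_finset] at hunion
  simp only [Finset.mem_coe] at hunion
  rw [ncard_numericalSetsOf hf, hunion] at hcard
  exact_mod_cast hcard

theorem stmt15 (γ : Finset ℕ → ℝ)
    (hγ : ∀ D : Finset ℕ, (∀ d ∈ D, 0 < d) →
      Tendsto (fun f : ℕ => density (NSet D f)) atTop (nhds (γ D))) :
    HasSum (fun D : {D : Finset ℕ // ∀ d ∈ D, 0 < d} => γ D.1) 1 := by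
  have hnonneg : ∀ D : {D : Finset ℕ // ∀ d ∈ D, 0 < d}, 0 ≤ γ D.1 := fun D =>
    ge_of_tendsto' (hγ D.1 D.2) fun f => by unfold density; positivity
  refine hasSum_of_isLUB_of_nonneg _ hnonneg ⟨?_, fun b hb => le_of_forall_pos_sub_le fun ε hε => ?_⟩
  · rintro _ ⟨s, rfl⟩
    refine le_of_tendsto (tendsto_finsetSum s fun D _ => hγ D.1 D.2) ?_
    filter_upwards [eventually_gt_atTop 0,
      eventually_gt_atTop (s.sup fun D => D.1.sup id)] with f hf hsf
    have h := sum_density_le_one (s.map (Function.Embedding.subtype _)) (f := f) ?_ hf ?_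
    · simpa using h
    · intro D hD
      obtain ⟨E, -, rfl⟩ := Finset.mem_map.1 hD
      exact E.2
    · intro D hD d hd
      obtain ⟨E, hE, rfl⟩ := Finset.mem_map.1 hD
      exact ((Finset.le_sup (f := id) hd).trans
        (Finset.le_sup (f := fun D : {D : Finset ℕ // ∀ d ∈ D, 0 < d} => D.1.sup id) hE)).trans_lt
          hsf
  · have hlim : Tendsto (fun M : ℕ => 64 / 49 * 8 * (7 / 8 : ℝ) ^ (M + 1)) atTop (𝓝 0) := by
      have := (tendsto_pow_atTop_nhds_zero_of_lt_one (r := (7 / 8 : ℝ)) (by norm_num)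
        (by norm_num)).comp (tendsto_add_atTop_nat 1)
      simpa using this.const_mul (64 / 49 * 8)
    obtain ⟨M, hM⟩ := (hlim.eventually_lt_const hε).exists
    have hpos : ∀ D ∈ (Finset.Icc 1 M).powerset, ∀ d ∈ D, 0 < d := fun D hD d hd =>
      (Finset.mem_Icc.1 (Finset.mem_powerset.1 hD hd)).1
    have hsum : 1 - 64 / 49 * 8 * (7 / 8 : ℝ) ^ (M + 1) ≤
        ∑ D ∈ (Finset.Icc 1 M).powerset, γ D := by
      refine ge_of_tendsto (tendsto_finsetSum _ fun D hD => hγ D (hpos D hD)) ?_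
      filter_upwards [eventually_gt_atTop (3 * M)] with f hf using one_sub_le_sum_density hf
    have hb' := hb ⟨(Finset.Icc 1 M).powerset.subtype _, rfl⟩
    simp only [Finset.sum_subtype_of_mem γ hpos] at hb'
    linarith
end

section
/- Let (S_n) be a sequence of numerical semigroups such that R(S_n) → ∞ as n → ∞. Then μ(S_n) → 0 as n → ∞. -/
open Filter Topology Set

/-- Subsets of `U` that contain `i + M` whenever they contain some `i ∈ I` have proportion at most
`(3/4) ^ #I`, provided the pairs `{i, i + M}` are disjoint and contained in `U`. -/
theorem card_filter_shift_closed_mul_le (M : ℕ) (I U : Finset ℕ)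
    (hU : ∀ i ∈ I, i ∈ U ∧ i + M ∈ U) (hI : ∀ i ∈ I, ∀ j ∈ I, i ≠ j + M) :
    (U.powerset.filter fun T => ∀ i ∈ I, i ∈ T → i + M ∈ T).card * 4 ^ I.card
      ≤ 3 ^ I.card * 2 ^ U.card := by
  induction I using Finset.induction_on generalizing U with
  | empty => simp
  | insert a I ha ih =>
    have haU := hU a (Finset.mem_insert_self a I)
    have hne : a ≠ a + M :=
      hI a (Finset.mem_insert_self a I) a (Finset.mem_insert_self a I)
    set V := (U.erase a).erase (a + M) with hV
    have hcard : U.card = V.card + 2 := by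
      have h1 := Finset.card_erase_add_one haU.1
      have h2 := Finset.card_erase_add_one
        (show a + M ∈ U.erase a from Finset.mem_erase.2 ⟨hne.symm, haU.2⟩)
      rw [← hV] at h2
      omega
    have hsep : ∀ i ∈ I, i ≠ a ∧ i ≠ a + M ∧ i + M ≠ a ∧ i + M ≠ a + M := by
      intro i hi
      have h1 : i ≠ a := fun h => ha (h ▸ hi)
      exact ⟨h1,
        hI i (Finset.mem_insert_of_mem hi) a (Finset.mem_insert_self a I),
        (hI a (Finset.mem_insert_self a I) i (Finset.mem_insert_of_mem hi)).symm,
        fun h => h1 (by omega)⟩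
    have hrec := ih V
      (fun i hi => by
        have := hsep i hi
        have := hU i (Finset.mem_insert_of_mem hi)
        simp only [hV, Finset.mem_erase]
        tauto)
      (fun i hi j hj => hI i (Finset.mem_insert_of_mem hi) j (Finset.mem_insert_of_mem hj))
    set F := U.powerset.filter fun T => ∀ i ∈ insert a I, i ∈ T → i + M ∈ T with hF
    set G := V.powerset.filter fun T => ∀ i ∈ I, i ∈ T → i + M ∈ T with hG
    have himage : F.image (fun T => (T.erase a).erase (a + M)) ⊆ G := by
      intro B hB
      obtain ⟨T, hT, rfl⟩ := Finset.mem_image.1 hB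
      rw [hF, Finset.mem_filter, Finset.mem_powerset] at hT
      rw [hG, Finset.mem_filter, Finset.mem_powerset]
      refine ⟨Finset.erase_subset_erase _ (Finset.erase_subset_erase _ hT.1), ?_⟩
      intro i hi hiT
      have h1 := hsep i hi
      have h2 := hT.2 i (Finset.mem_insert_of_mem hi)
      simp only [Finset.mem_erase] at hiT ⊢
      tauto
    have hfiber : ∀ B ∈ F.image (fun T => (T.erase a).erase (a + M)),
        (F.filter fun T => (T.erase a).erase (a + M) = B).card ≤ 3 := by
      intro B _
      refine (Finset.card_le_card (t := {B, insert (a + M) B, insert a (insert (a + M) B)})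
        ?_).trans Finset.card_le_three
      intro T hT
      obtain ⟨hTF, rfl⟩ := Finset.mem_filter.1 hT
      rw [hF, Finset.mem_filter] at hTF
      have himp := hTF.2 a (Finset.mem_insert_self a I)
      simp only [Finset.mem_insert, Finset.mem_singleton]
      by_cases h1 : a ∈ T
      · right; right
        rw [Finset.insert_erase (Finset.mem_erase.2 ⟨hne.symm, himp h1⟩), Finset.insert_erase h1]
      · rw [Finset.erase_eq_of_notMem h1]
        by_cases h2 : a + M ∈ T
        · right; left
          rw [Finset.insert_erase h2]
        · left
          rw [Finset.erase_eq_of_notMem h2]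
    have hle : F.card ≤ 3 * G.card :=
      (Finset.card_le_mul_card_image F 3 hfiber).trans
        (Nat.mul_le_mul_left 3 (Finset.card_le_card himage))
    rw [Finset.card_insert_of_notMem ha, hcard, pow_succ, pow_succ, pow_add]
    calc F.card * (4 ^ I.card * 4) ≤ 3 * G.card * (4 ^ I.card * 4) := Nat.mul_le_mul_right _ hle
      _ = 12 * (G.card * 4 ^ I.card) := by ring
      _ ≤ 12 * (3 ^ I.card * 2 ^ V.card) := Nat.mul_le_mul_left _ hrec
      _ = 3 ^ I.card * 3 * (2 ^ V.card * 2 ^ 2) := by ring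

theorem IsNumericalSet.frob_notMem {S : Set ℕ} (hS : IsNumericalSet S) : frob S ∉ S :=
  Nat.sSup_mem hS.2.2 hS.2.1.bddAbove

theorem IsNumericalSet.mem_of_frob_lt {S : Set ℕ} (hS : IsNumericalSet S) {x : ℕ}
    (hx : frob S < x) : x ∈ S := by
  by_contra h
  exact absurd (le_csSup hS.2.1.bddAbove h) (not_le.2 hx)

theorem IsNumericalSet.mult_mem {S : Set ℕ} (hS : IsNumericalSet S) :
    mult S ∈ S ∧ 0 < mult S :=
  Nat.sInf_mem (s := {x | x ∈ S ∧ 0 < x})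
    ⟨frob S + 1, hS.mem_of_frob_lt (Nat.lt_succ_self _), Nat.succ_pos _⟩

theorem IsNumericalSemigroup.mul_mem {S : Set ℕ} (hS : IsNumericalSemigroup S) {x : ℕ}
    (hx : x ∈ S) (a : ℕ) : x * a ∈ S := by
  induction a with
  | zero => exact hS.1.1
  | succ a ih => exact hS.2 _ ih _ hx

theorem PCount_le_card_filter {S : Set ℕ} (hS : IsNumericalSet S) {M : ℕ} (hM : M ∈ S)
    {I : Finset ℕ} (hI : ∀ i ∈ I, i + M < frob S) :
    PCount S ≤ ((Finset.Ioo 0 (frob S)).powerset.filter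
      fun T => ∀ i ∈ I, i ∈ T → i + M ∈ T).card := by
  classical
  rw [← Set.ncard_coe_finset]
  refine Set.ncard_le_ncard_of_injOn (fun T => (Finset.Ioo 0 (frob S)).filter (· ∈ T))
    ?_ ?_ (Finset.finite_toSet _)
  · rintro T ⟨-, rfl⟩
    rw [Finset.mem_coe, Finset.mem_filter, Finset.mem_powerset]
    refine ⟨Finset.filter_subset _ _, fun i hi hiT => ?_⟩
    have hlt := hI i hi
    simp only [Finset.mem_filter, Finset.mem_Ioo] at hiT ⊢
    refine ⟨⟨by omega, hlt⟩, ?_⟩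
    rw [add_comm]
    exact hM i hiT.2
  · have hgt : ∀ T, IsNumericalSet T → AT T = S → ∀ x, frob S < x → x ∈ T := by
      intro T hT hTS x hx
      have h : x ∈ AT T := hTS ▸ hS.mem_of_frob_lt hx
      exact h 0 hT.1
    have hfrob : ∀ T, IsNumericalSet T → AT T = S → frob S ∉ T := by
      intro T hT hTS hf
      refine hS.frob_notMem ((Set.ext_iff.1 hTS _).1 fun x hx => ?_)
      rcases Nat.eq_zero_or_pos x with rfl | hpos
      · exact hf
      · exact hgt T hT hTS _ (by omega)
    rintro T ⟨hT, hTS⟩ T' ⟨hT', hTS'⟩ heq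
    ext x
    rcases Nat.eq_zero_or_pos x with rfl | hpos
    · exact iff_of_true hT.1 hT'.1
    rcases lt_trichotomy x (frob S) with hlt | rfl | hlt
    · simpa [hpos, hlt] using Finset.ext_iff.1 heq x
    · exact iff_of_false (hfrob T hT hTS) (hfrob T' hT' hTS')
    · exact iff_of_true (hgt T hT hTS x hlt) (hgt T' hT' hTS' x hlt)

theorem IsNumericalSemigroup.exists_mem_shift {S : Set ℕ} (hS : IsNumericalSemigroup S) {k : ℕ}
    (hk : 0 < k) (hR : 3 * (k : ℤ) ≤ RVal S) : ∃ M ∈ S, k ≤ M ∧ k + M < frob S := by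
  obtain ⟨hm, hpos⟩ := hS.1.mult_mem
  unfold RVal at hR
  rcases le_or_gt k (mult S) with h | h
  · exact ⟨mult S, hm, h, by omega⟩
  · refine ⟨mult S * (k / mult S + 1), hS.mul_mem hm _, ?_, ?_⟩
    · exact (Nat.lt_mul_div_succ k hpos).le
    · have := Nat.mul_div_le k (mult S)
      rw [Nat.mul_succ]
      omega

theorem IsNumericalSemigroup.density_le {S : Set ℕ} (hS : IsNumericalSemigroup S) {k : ℕ}
    (hk : 0 < k) (hR : 3 * (k : ℤ) ≤ RVal S) : density S ≤ (3 / 4 : ℝ) ^ k := by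
  obtain ⟨M, hM, hkM, hlt⟩ := hS.exists_mem_shift hk hR
  have hle := card_filter_shift_closed_mul_le M (Finset.Ioc 0 k) (Finset.Ioo 0 (frob S))
    (fun i hi => by simp only [Finset.mem_Ioc, Finset.mem_Ioo] at hi ⊢; omega)
    (fun i hi j hj => by simp only [Finset.mem_Ioc] at hi hj; omega)
  have hP := PCount_le_card_filter hS.1 hM (I := Finset.Ioc 0 k)
    (fun i hi => by simp only [Finset.mem_Ioc] at hi; omega)
  have h := (Nat.mul_le_mul_right _ hP).trans hle
  simp only [Nat.card_Ioc, Nat.card_Ioo, Nat.sub_zero] at h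
  rw [density, div_pow, div_le_div_iff₀ (by positivity) (by positivity)]
  exact_mod_cast h

theorem stmt16 (S : ℕ → Set ℕ) (hS : ∀ n, IsNumericalSemigroup (S n))
    (hR : Tendsto (fun n => RVal (S n)) atTop atTop) :
    Tendsto (fun n => density (S n)) atTop (nhds 0) := by
  rw [Metric.tendsto_nhds]
  intro ε hε
  obtain ⟨k, hk⟩ := exists_pow_lt_of_lt_one hε (show (3 / 4 : ℝ) < 1 by norm_num)
  filter_upwards [hR.eventually_ge_atTop (3 * ((k + 1 : ℕ) : ℤ))] with n hn
  have hnonneg : 0 ≤ density (S n) := by unfold density; positivity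
  rw [Real.dist_0_eq_abs, abs_of_nonneg hnonneg]
  calc density (S n) ≤ (3 / 4 : ℝ) ^ (k + 1) := (hS n).density_le k.succ_pos hn
    _ ≤ (3 / 4 : ℝ) ^ k := pow_le_pow_of_le_one (by norm_num) (by norm_num) k.le_succ
    _ < ε := hk
end

section
/- Let (S_n) be a sequence of numerical semigroups with liminf_{n→∞} μ(S_n) > 0. Then the sequence R(S_n) is bounded. -/
open Filter Topology Set

theorem card_subsets_closed_add_mul_four_pow_le (m : ℕ) (hm : 0 < m) (P : Finset ℕ) :
    ∀ U : Finset ℕ, (∀ a ∈ P, a ∈ U ∧ a + m ∈ U) → (∀ a ∈ P, a + m ∉ P) →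
      (U.powerset.filter fun X => ∀ a ∈ P, a ∈ X → a + m ∈ X).card * 4 ^ P.card
        ≤ 3 ^ P.card * 2 ^ U.card := by
  induction P using Finset.induction_on with
  | empty => intro U _ _; simp
  | insert a P ha ih =>
    intro U hU hP
    have haU := hU a (Finset.mem_insert_self a P)
    have hne : a ≠ a + m := by omega
    have hsub : ({a, a + m} : Finset ℕ) ⊆ U := by
      intro x hx
      simp only [Finset.mem_insert, Finset.mem_singleton] at hx
      rcases hx with rfl | rfl
      exacts [haU.1, haU.2]
    have hcard : (U \ {a, a + m}).card + 2 = U.card := by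
      rw [← Finset.card_pair hne]
      exact Finset.card_sdiff_add_card_eq_card hsub
    have hdisj : ∀ b ∈ P, b ≠ a ∧ b ≠ a + m ∧ b + m ≠ a ∧ b + m ≠ a + m := by
      intro b hb
      have hba : b ≠ a := fun h => ha (h ▸ hb)
      refine ⟨hba, ?_, ?_, by omega⟩
      · rintro rfl
        exact hP a (Finset.mem_insert_self _ _) (Finset.mem_insert_of_mem hb)
      · intro h
        exact hP b (Finset.mem_insert_of_mem hb) (h ▸ Finset.mem_insert_self _ _)
    have hrec := ih (U \ {a, a + m})
      (by
        intro b hb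
        have h1 := hU b (Finset.mem_insert_of_mem hb)
        have h2 := hdisj b hb
        simp only [Finset.mem_sdiff, Finset.mem_insert, Finset.mem_singleton]
        tauto)
      (fun b hb hbm => hP b (Finset.mem_insert_of_mem hb) (Finset.mem_insert_of_mem hbm))
    have himage : (U.powerset.filter fun X => ∀ b ∈ insert a P, b ∈ X → b + m ∈ X) ⊆
        Finset.image₂ (· ∪ ·)
          ((U \ {a, a + m}).powerset.filter fun X => ∀ b ∈ P, b ∈ X → b + m ∈ X)
          {∅, {a + m}, {a, a + m}} := by
      intro X hX
      simp only [Finset.mem_filter, Finset.mem_powerset] at hX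
      obtain ⟨hXU, hX⟩ := hX
      refine Finset.mem_image₂.2 ⟨X \ {a, a + m}, ?_, X ∩ {a, a + m}, ?_, ?_⟩
      · simp only [Finset.mem_filter, Finset.mem_powerset]
        refine ⟨Finset.sdiff_subset_sdiff hXU subset_rfl, fun b hb hbX => ?_⟩
        have h2 := hdisj b hb
        have h3 := hX b (Finset.mem_insert_of_mem hb)
        simp only [Finset.mem_sdiff, Finset.mem_insert, Finset.mem_singleton] at hbX ⊢
        tauto
      · have h3 := hX a (Finset.mem_insert_self a P)
        by_cases h1 : a ∈ X
        · have : X ∩ {a, a + m} = {a, a + m} := by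
            ext x
            simp only [Finset.mem_inter, Finset.mem_insert, Finset.mem_singleton]
            grind
          simp [this]
        · by_cases h2 : a + m ∈ X
          · have : X ∩ {a, a + m} = {a + m} := by
              ext x
              simp only [Finset.mem_inter, Finset.mem_insert, Finset.mem_singleton]
              grind
            simp [this]
          · have : X ∩ {a, a + m} = ∅ := by
              ext x
              simp only [Finset.mem_inter, Finset.mem_insert, Finset.mem_singleton,
                Finset.notMem_empty]
              grind
            simp [this]
      · exact Finset.sdiff_union_inter X _
    have hle := (Finset.card_le_card himage).trans (Finset.card_image₂_le _ _ _)
    have hle' := hle.trans (Nat.mul_le_mul_left _ Finset.card_le_three)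
    rw [Finset.card_insert_of_notMem ha, ← hcard, pow_succ, pow_succ, pow_add]
    nlinarith [Nat.mul_le_mul_right (4 ^ P.card) hle']

theorem exists_subset_Icc_add_notMem (m N : ℕ) (hm : 0 < m) :
    ∃ P ⊆ Finset.Icc 1 N, (∀ a ∈ P, a + m ∉ P) ∧ N ≤ 2 * P.card := by
  have hsum := Finset.card_filter_add_card_filter_not (s := Finset.Icc 1 N)
    (fun a => Even (a / m))
  rw [Nat.card_Icc, Nat.add_sub_cancel] at hsum
  rcases le_total ((Finset.Icc 1 N).filter fun a => Even (a / m)).card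
    ((Finset.Icc 1 N).filter fun a => ¬ Even (a / m)).card with h | h
  · refine ⟨(Finset.Icc 1 N).filter fun a => ¬ Even (a / m),
      Finset.filter_subset _ _, fun a ha ha' => ?_, by omega⟩
    simp only [Finset.mem_filter, Nat.add_div_right _ hm] at ha ha'
    exact ha'.2 (Nat.even_add_one.2 ha.2)
  · refine ⟨(Finset.Icc 1 N).filter fun a => Even (a / m),
      Finset.filter_subset _ _, fun a ha ha' => ?_, by omega⟩
    simp only [Finset.mem_filter, Nat.add_div_right _ hm] at ha ha'
    exact Nat.even_add_one.1 ha'.2 ha.2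

namespace IsNumericalSet

variable {S : Set ℕ}

theorem mem_of_frob_lt_s17 (h : IsNumericalSet S) {x : ℕ} (hx : frob S < x) : x ∈ S := by
  by_contra hxS
  exact absurd (le_csSup h.2.1.bddAbove hxS) (not_le.2 hx)

theorem frob_notMem_s17 (h : IsNumericalSet S) : frob S ∉ S :=
  Nat.sSup_mem h.2.2 h.2.1.bddAbove

theorem mult_mem_and_pos (h : IsNumericalSet S) : mult S ∈ S ∧ 0 < mult S :=
  Nat.sInf_mem (s := {x | x ∈ S ∧ 0 < x})
    ⟨frob S + 1, h.mem_of_frob_lt_s17 (Nat.lt_succ_self _), Nat.succ_pos _⟩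

theorem mult_le_frob_add_one (h : IsNumericalSet S) : mult S ≤ frob S + 1 :=
  Nat.sInf_le ⟨h.mem_of_frob_lt_s17 (Nat.lt_succ_self _), Nat.succ_pos _⟩

theorem mem_iff_of_AT_eq {T : Set ℕ} (h : IsNumericalSet S) (hT : IsNumericalSet T)
    (hTS : AT T = S) {x : ℕ} (hx : x ∉ Finset.Icc 1 (frob S - 1)) :
    x ∈ T ↔ x = 0 ∨ frob S < x := by
  have hsub : ∀ y ∈ S, y ∈ T := by
    intro y hy
    rw [← hTS] at hy
    simpa using hy 0 hT.1
  have hfrob : frob S ∉ T := by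
    intro hf
    have hnot : frob S ∉ AT T := hTS ▸ h.frob_notMem_s17
    apply hnot
    intro y hy
    rcases Nat.eq_zero_or_pos y with rfl | hy0
    · simpa using hf
    · exact hsub _ (h.mem_of_frob_lt_s17 (by omega))
  constructor
  · intro hxT
    have hne : x ≠ frob S := fun he => hfrob (he ▸ hxT)
    simp only [Finset.mem_Icc] at hx
    omega
  · rintro (rfl | hlt)
    exacts [hT.1, hsub _ (h.mem_of_frob_lt_s17 hlt)]

theorem PCount_le (h : IsNumericalSet S) (P : Finset ℕ) :
    PCount S ≤ ((Finset.Icc 1 (frob S - 1)).powerset.filter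
      fun X => ∀ a ∈ P, a ∈ X → a + mult S ∈ X ∨
        a + mult S ∉ Finset.Icc 1 (frob S - 1)).card := by
  classical
  rw [← Set.ncard_coe_finset]
  refine Set.ncard_le_ncard_of_injOn
    (fun T => (Finset.Icc 1 (frob S - 1)).filter (· ∈ T)) ?_ ?_ (Finset.finite_toSet _)
  · rintro T ⟨-, hTS⟩
    rw [Finset.mem_coe, Finset.mem_filter, Finset.mem_powerset]
    refine ⟨Finset.filter_subset _ _, fun a _ haX => ?_⟩
    have hm : mult S ∈ AT T := hTS ▸ h.mult_mem_and_pos.1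
    have haT := hm a (Finset.mem_filter.1 haX).2
    rw [add_comm] at haT
    simp only [Finset.mem_filter]
    tauto
  · rintro T ⟨hT, hTS⟩ T' ⟨hT', hTS'⟩ heq
    ext x
    by_cases hx : x ∈ Finset.Icc 1 (frob S - 1)
    · have := Finset.ext_iff.1 heq x
      simpa only [Finset.mem_filter, hx, true_and] using this
    · rw [h.mem_iff_of_AT_eq hT hTS hx, h.mem_iff_of_AT_eq hT' hTS' hx]

theorem exists_density_le (h : IsNumericalSet S) :
    ∃ p : ℕ, density S ≤ (3 / 4) ^ p ∧ RVal S ≤ 2 * p + 1 := by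
  obtain ⟨P, hPN, hP, hcard⟩ :=
    exists_subset_Icc_add_notMem (mult S) (frob S - 1 - mult S) h.mult_mem_and_pos.2
  have hPU : ∀ a ∈ P, a ∈ Finset.Icc 1 (frob S - 1) ∧
      a + mult S ∈ Finset.Icc 1 (frob S - 1) := by
    intro a ha
    have := hPN ha
    simp only [Finset.mem_Icc] at this ⊢
    omega
  refine ⟨P.card, ?_, by unfold RVal; omega⟩
  have hcount : PCount S * 4 ^ P.card ≤ 3 ^ P.card * 2 ^ (frob S - 1) := by
    have hmain := card_subsets_closed_add_mul_four_pow_le (mult S) h.mult_mem_and_pos.2 P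
      (Finset.Icc 1 (frob S - 1)) hPU hP
    rw [Nat.card_Icc, Nat.add_sub_cancel] at hmain
    refine (Nat.mul_le_mul_right _ ((h.PCount_le P).trans (Finset.card_le_card ?_))).trans hmain
    intro X hX
    rw [Finset.mem_filter] at hX ⊢
    exact ⟨hX.1, fun a ha haX => (hX.2 a ha haX).resolve_right (not_not.2 (hPU a ha).2)⟩
  have hcount' : (PCount S : ℝ) * 4 ^ P.card ≤ 3 ^ P.card * 2 ^ (frob S - 1) := by
    exact_mod_cast hcount
  unfold density
  rw [div_pow, div_le_div_iff₀ (by positivity) (by positivity)]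
  exact hcount'

end IsNumericalSet

theorem stmt17 (S : ℕ → Set ℕ) (hS : ∀ n, IsNumericalSemigroup (S n))
    (hliminf : 0 < Filter.liminf (fun n => density (S n)) atTop) :
    ∃ M : ℝ, ∀ n, |(RVal (S n) : ℝ)| ≤ M := by
  obtain ⟨ε, hε, hεlim⟩ := exists_between hliminf
  have hev : ∀ᶠ n in atTop, ε < density (S n) :=
    eventually_lt_of_lt_liminf hεlim
      (isBoundedUnder_of ⟨0, fun n => by unfold density; positivity⟩)
  obtain ⟨K, hK⟩ := exists_pow_lt_of_lt_one hε (show (3 / 4 : ℝ) < 1 by norm_num)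
  have hbdd : IsBoundedUnder (· ≤ ·) atTop (fun n => |(RVal (S n) : ℝ)|) := by
    refine ⟨2 * K + 1, eventually_map.2 (hev.mono fun n hn => ?_)⟩
    obtain ⟨p, hp, hR⟩ := (hS n).1.exists_density_le
    have hpK : p < K := (pow_lt_pow_iff_right_of_lt_one₀ (by norm_num) (by norm_num)).1
      (hK.trans (hn.trans_le hp))
    have hlow := (hS n).1.mult_le_frob_add_one
    have habs : |RVal (S n)| ≤ 2 * K + 1 := by
      rw [abs_le]
      unfold RVal at hR ⊢
      omega
    exact_mod_cast habs
  obtain ⟨M, hM⟩ := hbdd.bddAbove_range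
  exact ⟨M, fun n => hM (Set.mem_range_self n)⟩
end
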